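/- arXiv:1210.3433 — 2 statements merged into one kernel-verified Lean document; each statement's English description precedes it below -/
import Mathlib

section
/- Let f(x,y) ∈ ℤ[x,y] be a squarefree, non-constant polynomial in two variables. Then the series Σ_{n squarefree, n ≥ 1} |C_f(n²)| / |GL₂(ℤ/n²ℤ)|, summed over all squarefree positive integers n, converges (i.e., the function n ↦ |C_f(n²)|/|GL₂(ℤ/n²ℤ)| restricted to squarefree n is summable over ℝ). -/
open Matrix MvPolynomial

/-- The set `C_f(n)` of matrices `g ∈ GL₂(ℤ/nℤ)` with `f(tr g, det g) ≡ 0 (mod n)`. -/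
def Cf (f : MvPolynomial (Fin 2) ℤ) (n : ℕ) : Set (GL (Fin 2) (ZMod n)) :=
  {g | MvPolynomial.aeval
      ![Matrix.trace (g : Matrix (Fin 2) (Fin 2) (ZMod n)),
        Matrix.det (g : Matrix (Fin 2) (Fin 2) (ZMod n))] f = 0}


section Separability

open Polynomial nonZeroDivisors

variable {R : Type*} [CommRing R] [IsDomain R] [UniqueFactorizationMonoid R]

/-- Over a unique factorization domain, a squarefree polynomial stays squarefree over the fraction
field. -/
theorem Polynomial.squarefree_map_fractionRing {F : R[X]} (hF : Squarefree F) :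
    Squarefree (F.map (algebraMap R (FractionRing R))) := by
  let : NormalizedGCDMonoid R := Nonempty.some inferInstance
  intro g hg
  have hF0 : F.map (algebraMap R (FractionRing R)) ≠ 0 :=
    (Polynomial.map_ne_zero_iff (IsFractionRing.injective R (FractionRing R))).2 hF.ne_zero
  have hg0 : g ≠ 0 := by
    rintro rfl
    exact hF0 (by simpa using hg)
  set q := IsLocalization.integerNormalization R⁰ g with hq
  obtain ⟨b, hbm, hb⟩ := IsLocalization.integerNormalization_spec R⁰ g
  have hprim := q.isPrimitive_primPart
  have hdvd : q.primPart.map (algebraMap R (FractionRing R)) ∣ g := by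
    have h1 : q.primPart.map (algebraMap R (FractionRing R)) ∣ b • g := by
      rw [← hb]
      exact Polynomial.map_dvd _ q.primPart_dvd
    rw [Algebra.smul_def] at h1
    refine (IsUnit.dvd_mul_left ?_).1 h1
    rw [IsScalarTower.algebraMap_apply R (FractionRing R) (FractionRing R)[X]]
    exact (IsLocalization.map_units (FractionRing R) (⟨b, hbm⟩ : R⁰)).map _
  have hsq : q.primPart * q.primPart ∣ F := by
    refine (hprim.mul hprim).dvd_of_fraction_map_dvd_fraction_map (K := FractionRing R) ?_
    rw [Polynomial.map_mul]
    exact (mul_dvd_mul hdvd hdvd).trans hg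
  exact (isUnit_or_eq_zero_of_isUnit_integerNormalization_primPart hg0 (hF _ hsq))

/-- A squarefree polynomial over a unique factorization domain of characteristic zero generates,
together with its derivative, an ideal containing a nonzero constant. -/
theorem Polynomial.exists_C_eq_mul_add_mul_derivative [CharZero R] {F : R[X]}
    (hF : Squarefree F) :
    ∃ D : R, D ≠ 0 ∧ ∃ A B : R[X], C D = A * F + B * derivative F := by
  have : CharZero (FractionRing R) :=
    charZero_of_injective_algebraMap (IsFractionRing.injective R (FractionRing R))
  have hsep := PerfectField.separable_iff_squarefree.2 (squarefree_map_fractionRing hF)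
  obtain ⟨a, b, hab⟩ := hsep
  obtain ⟨s, hsm, hs⟩ := IsLocalization.integerNormalization_spec R⁰ a
  obtain ⟨t, htm, ht⟩ := IsLocalization.integerNormalization_spec R⁰ b
  refine ⟨s * t, mul_ne_zero (nonZeroDivisors.ne_zero hsm) (nonZeroDivisors.ne_zero htm),
    C t * IsLocalization.integerNormalization R⁰ a,
    C s * IsLocalization.integerNormalization R⁰ b, ?_⟩
  apply Polynomial.map_injective _ (IsFractionRing.injective R (FractionRing R))
  simp only [Polynomial.map_add, Polynomial.map_mul, hs, ht, Polynomial.map_C, map_mul]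
  rw [Polynomial.derivative_map] at hab
  simp only [Algebra.smul_def,
    IsScalarTower.algebraMap_apply R (FractionRing R) (FractionRing R)[X], Polynomial.algebraMap_eq]
  linear_combination
    (-C (algebraMap R (FractionRing R) s) * C (algebraMap R (FractionRing R) t)) * hab

end Separability

theorem squarefree_mulEquiv {M N E : Type*} [CommMonoid M] [CommMonoid N] [EquivLike E M N]
    [MulEquivClass E M N] (e : E) {x : M} (hx : Squarefree x) : Squarefree (e x) := by
  intro g hg
  obtain ⟨g, rfl⟩ := EquivLike.surjective e g
  rw [← map_mul, map_dvd_iff] at hg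
  exact (hx g hg).map e

theorem aeval_eq_eval_map_finSuccEquiv {R : Type*} [CommRing R] (f : MvPolynomial (Fin 2) ℤ)
    (x y : R) :
    aeval ![x, y] f =
      ((finSuccEquiv ℤ 1 f).map (aeval ![y] : MvPolynomial (Fin 1) ℤ →ₐ[ℤ] R).toRingHom).eval x := by
  have : (aeval ![x, y] : MvPolynomial (Fin 2) ℤ →ₐ[ℤ] R).toRingHom =
      ((Polynomial.evalRingHom x).comp (Polynomial.mapRingHom
        (aeval ![y] : MvPolynomial (Fin 1) ℤ →ₐ[ℤ] R).toRingHom)).comp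
          (finSuccEquiv ℤ 1 : MvPolynomial (Fin 2) ℤ →+* _) := by
    apply MvPolynomial.ringHom_ext
    · intro r; simp
    · intro i
      fin_cases i
      · simp [finSuccEquiv_X_zero]
      · have := finSuccEquiv_X_succ (R := ℤ) (n := 1) (j := 0)
        simp at this
        simp [this]
  exact congrArg (fun φ => φ f) this

/-- For a squarefree bivariate `f` there is a polynomial `h` (its derivative in the first variable)
such that the second coordinate of a common zero of `f` and `h` is a root of a fixed nonzero `D`,
and such that zeros of `f` at which `h` is a unit are rigid in the first variable. -/
theorem exists_partial_derivative (f : MvPolynomial (Fin 2) ℤ) (hf : Squarefree f) :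
    ∃ (h : MvPolynomial (Fin 2) ℤ) (D : MvPolynomial (Fin 1) ℤ), D ≠ 0 ∧
      (∀ (R : Type) [CommRing R] (x y : R), aeval ![x, y] f = 0 → aeval ![x, y] h = 0 →
        aeval ![y] D = 0) ∧
      (∀ (R : Type) [CommRing R] (x x' y : R), aeval ![x, y] f = 0 → aeval ![x', y] f = 0 →
        (x' - x) ^ 2 = 0 → IsUnit (aeval ![x, y] h) → x' = x) := by
  have hF : Squarefree (finSuccEquiv ℤ 1 f) := squarefree_mulEquiv (finSuccEquiv ℤ 1) hf
  obtain ⟨D, hD, A, B, hAB⟩ := Polynomial.exists_C_eq_mul_add_mul_derivative hF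
  refine ⟨(finSuccEquiv ℤ 1).symm (Polynomial.derivative (finSuccEquiv ℤ 1 f)), D, hD, ?_, ?_⟩
  · intro R _ x y h1 h2
    rw [aeval_eq_eval_map_finSuccEquiv] at h1 h2
    rw [AlgEquiv.apply_symm_apply] at h2
    have := congrArg (fun P => (P.map (aeval ![y] :
      MvPolynomial (Fin 1) ℤ →ₐ[ℤ] R).toRingHom).eval x) hAB
    simp only [Polynomial.map_add, Polynomial.map_mul, Polynomial.eval_add, Polynomial.eval_mul,
      h1, h2, Polynomial.map_C, Polynomial.eval_C] at this
    simpa using this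
  · intro R _ x x' y h1 h2 h3 h4
    rw [aeval_eq_eval_map_finSuccEquiv] at h1 h2 h4
    rw [AlgEquiv.apply_symm_apply] at h4
    obtain ⟨k, hk⟩ := Polynomial.binomExpansion ((finSuccEquiv ℤ 1 f).map
      (aeval ![y] : MvPolynomial (Fin 1) ℤ →ₐ[ℤ] R).toRingHom) x (x' - x)
    rw [add_sub_cancel, h1, h2, h3, Polynomial.derivative_map] at hk
    have : Polynomial.eval x (Polynomial.map (aeval ![y] :
      MvPolynomial (Fin 1) ℤ →ₐ[ℤ] R).toRingHom (Polynomial.derivative (finSuccEquiv ℤ 1 f))) *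
        (x' - x) = 0 := by linear_combination -hk
    exact sub_eq_zero.1 ((h4.mul_right_eq_zero).1 this)

theorem aeval_rename_swap {R : Type*} [CommRing R] (f : MvPolynomial (Fin 2) ℤ) (x y : R) :
    aeval ![y, x] (rename (Equiv.swap 0 1) f) = aeval ![x, y] f := by
  rw [aeval_rename]
  congr 2
  ext i
  fin_cases i <;> simp

/-- A nonzero integral polynomial in `n` variables has `O(p ^ (n - 1))` zeros modulo `p`. -/
theorem exists_card_zeros_mod_prime_le {n : ℕ} (g : MvPolynomial (Fin n) ℤ) (hg : g ≠ 0) :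
    ∃ C P : ℕ, ∀ p : ℕ, p.Prime → P < p →
      Nat.card {v : Fin n → ZMod p // aeval v g = 0} * p ≤ C * p ^ n := by
  obtain ⟨m, hm⟩ := MvPolynomial.ne_zero_iff.1 hg
  refine ⟨g.totalDegree, (g.coeff m).natAbs, fun p hp hlt => ?_⟩
  have := Fact.mk hp
  have hne : map (Int.castRingHom (ZMod p)) g ≠ 0 := by
    rw [MvPolynomial.ne_zero_iff]
    refine ⟨m, ?_⟩
    rw [coeff_map, eq_intCast, Ne, ZMod.intCast_zmod_eq_zero_iff_dvd]
    intro h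
    have := Int.natAbs_dvd_natAbs.2 h
    rw [Int.natAbs_natCast] at this
    exact absurd (Nat.le_of_dvd (Int.natAbs_pos.2 hm) this) (by omega)
  have hsz := schwartz_zippel_totalDegree hne Finset.univ
  have hcard : Nat.card {v : Fin n → ZMod p // aeval v g = 0} =
      (Finset.filter (fun v => eval v (map (Int.castRingHom (ZMod p)) g) = 0)
        (Fintype.piFinset fun _ => (Finset.univ : Finset (ZMod p)))).card := by
    refine Nat.subtype_card _ fun v => ?_
    simp [aeval_def, eval_map]
  rw [← hcard] at hsz
  have hp0 : (0 : ℚ≥0) < p := by exact_mod_cast hp.pos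
  rw [Finset.card_univ, ZMod.card, div_le_div_iff₀ (by positivity) hp0] at hsz
  have h2 : Nat.card {v : Fin n → ZMod p // aeval v g = 0} * p ≤
    (map (Int.castRingHom (ZMod p)) g).totalDegree * p ^ n := by exact_mod_cast hsz
  exact h2.trans (Nat.mul_le_mul_right _ (Finset.sup_mono (support_map_subset _ _)))

theorem map_aeval_pair {R S : Type*} [CommRing R] [CommRing S] (π : R →+* S) (x y : R)
    (g : MvPolynomial (Fin 2) ℤ) : π (aeval ![x, y] g) = aeval ![π x, π y] g := by
  have := comp_aeval_apply (f := ![x, y]) π.toIntAlgHom g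
  rw [show (fun i => π.toIntAlgHom (![x, y] i)) = ![π x, π y] by
    ext i; fin_cases i <;> rfl] at this
  exact this

section Counting

variable {R k : Type} [CommRing R] [Fintype R] [Field k] [DecidableEq k]

theorem card_fiber_le_card_ker (π : R →+* k) (c : k) :
    (Finset.univ.filter fun x => π x = c).card ≤ (Finset.univ.filter fun x => π x = 0).card := by
  by_cases h : ∃ x₀, π x₀ = c
  · obtain ⟨x₀, hx₀⟩ := h
    refine Finset.card_le_card_of_injOn (fun x => x - x₀) ?_ (sub_left_injective.injOn)
    intro x hx
    simp only [Finset.coe_filter, Finset.mem_univ, true_and, Set.mem_ofPred_eq] at hx ⊢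
    rw [map_sub, hx, hx₀, sub_self]
  · push Not at h
    rw [Finset.filter_false_of_mem fun x _ => h x]
    simp

theorem card_mul_eq_le [DecidableEq R] (π : R →+* k) (hunit : ∀ x, π x ≠ 0 → IsUnit x) (m : R) :
    (Finset.univ.filter fun x : R × R => x.1 * x.2 = m).card ≤
      2 * Fintype.card R + (Finset.univ.filter fun x => π x = 0).card ^ 2 := by
  have hsub : (Finset.univ.filter fun x : R × R => x.1 * x.2 = m) ⊆
      ((Finset.univ.filter fun x : R × R => x.1 * x.2 = m ∧ π x.1 ≠ 0) ∪
        (Finset.univ.filter fun x : R × R => x.1 * x.2 = m ∧ π x.2 ≠ 0)) ∪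
        (Finset.univ.filter fun x => π x = 0) ×ˢ (Finset.univ.filter fun x => π x = 0) := by
    intro x hx
    simp only [Finset.mem_union, Finset.mem_filter, Finset.mem_univ, true_and,
      Finset.mem_product] at hx ⊢
    tauto
  have h1 : (Finset.univ.filter fun x : R × R => x.1 * x.2 = m ∧ π x.1 ≠ 0).card ≤
      Fintype.card R := by
    refine Finset.card_le_card_of_injOn (t := Finset.univ) Prod.fst (by simp) ?_
    rintro ⟨a, b⟩ hx ⟨a', b'⟩ hy (rfl : a = a')
    simp only [Finset.coe_filter, Finset.mem_univ, true_and, Set.mem_ofPred_eq] at hx hy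
    rw [(hunit _ hx.2).mul_left_cancel (hx.1.trans hy.1.symm)]
  have h2 : (Finset.univ.filter fun x : R × R => x.1 * x.2 = m ∧ π x.2 ≠ 0).card ≤
      Fintype.card R := by
    refine Finset.card_le_card_of_injOn (t := Finset.univ) Prod.snd (by simp) ?_
    rintro ⟨a, b⟩ hx ⟨a', b'⟩ hy (rfl : b = b')
    simp only [Finset.coe_filter, Finset.mem_univ, true_and, Set.mem_ofPred_eq] at hx hy
    rw [(hunit _ hx.2).mul_right_cancel (hx.1.trans hy.1.symm)]
  refine (Finset.card_le_card hsub).trans <| (Finset.card_union_le _ _).trans ?_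
  rw [Finset.card_product, ← sq]
  have := Finset.card_union_le (Finset.univ.filter fun x : R × R => x.1 * x.2 = m ∧ π x.1 ≠ 0)
    (Finset.univ.filter fun x : R × R => x.1 * x.2 = m ∧ π x.2 ≠ 0)
  omega

/-- Zeros of `f` over `R`, grouped by their reduction along `π : R → k`: over a smooth point there
are at most `#ker π` zeros, over a singular point at most `(#ker π) ^ 2`. -/
theorem card_zeros_le [DecidableEq R] [Fintype k] (π : R →+* k) (hunit : ∀ x, π x ≠ 0 → IsUnit x)
    (hsq : ∀ x, π x = 0 → x ^ 2 = 0) (f h₀ h₁ : MvPolynomial (Fin 2) ℤ)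
    (hf₀ : ∀ x x' y : R, aeval ![x, y] f = 0 → aeval ![x', y] f = 0 →
        (x' - x) ^ 2 = 0 → IsUnit (aeval ![x, y] h₀) → x' = x)
    (hf₁ : ∀ x y y' : R, aeval ![x, y] f = 0 → aeval ![x, y'] f = 0 →
        (y' - y) ^ 2 = 0 → IsUnit (aeval ![x, y] h₁) → y' = y) :
    (Finset.univ.filter fun v : R × R => aeval ![v.1, v.2] f = 0).card ≤
      (Finset.univ.filter fun x => π x = 0).card *
        (Finset.univ.filter fun v : k × k => aeval ![v.1, v.2] f = 0).card +
      (Finset.univ.filter fun x => π x = 0).card ^ 2 *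
        (Finset.univ.filter fun v : k × k => aeval ![v.1, v.2] f = 0 ∧
          aeval ![v.1, v.2] h₀ = 0 ∧ aeval ![v.1, v.2] h₁ = 0).card := by
  have hπ (x y : R) (g : MvPolynomial (Fin 2) ℤ) := map_aeval_pair π x y g
  let red : R × R → k × k := fun v => (π v.1, π v.2)
  let S := Finset.univ.filter fun v : R × R => aeval ![v.1, v.2] f = 0
  let sing : k × k → Prop := fun v => aeval ![v.1, v.2] h₀ = 0 ∧ aeval ![v.1, v.2] h₁ = 0
  have hsplit := S.card_filter_add_card_filter_not (fun v => sing (red v))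
  have hred : ∀ v ∈ S, aeval ![(red v).1, (red v).2] f = 0 := by
    intro v hv
    rw [← hπ, (Finset.mem_filter.1 hv).2, map_zero]
  have hdiff (x x' : R) (hx : π x = π x') : (x' - x) ^ 2 = 0 :=
    hsq _ (by rw [map_sub, hx, sub_self])
  have hsing : (S.filter fun v => sing (red v)).card ≤
      (Finset.univ.filter fun x => π x = 0).card ^ 2 *
        (Finset.univ.filter fun v : k × k => aeval ![v.1, v.2] f = 0 ∧
          aeval ![v.1, v.2] h₀ = 0 ∧ aeval ![v.1, v.2] h₁ = 0).card := by
    refine Finset.card_le_mul_card_image_of_maps_to (f := red) ?_ _ ?_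
    · intro v hv
      rw [Finset.mem_filter] at hv
      simpa using ⟨hred v hv.1, hv.2⟩
    · intro w _
      refine (Finset.card_le_card (t := (Finset.univ.filter fun x => π x = w.1) ×ˢ
        (Finset.univ.filter fun x => π x = w.2)) ?_).trans ?_
      · intro v hv
        have : red v = w := (Finset.mem_filter.1 hv).2
        simp [← this, red]
      · rw [Finset.card_product, sq]
        exact Nat.mul_le_mul (card_fiber_le_card_ker π _) (card_fiber_le_card_ker π _)
  have hsmooth : (S.filter fun v => ¬ sing (red v)).card ≤
      (Finset.univ.filter fun x => π x = 0).card *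
        (Finset.univ.filter fun v : k × k => aeval ![v.1, v.2] f = 0).card := by
    refine Finset.card_le_mul_card_image_of_maps_to (f := red) ?_ _ ?_
    · intro v hv
      rw [Finset.mem_filter] at hv
      simpa using hred v hv.1
    · intro w _
      have hmem (v : R × R) : v ∈ ((S.filter fun v => ¬ sing (red v)).filter
          fun v => red v = w : Finset (R × R)) ↔
          (aeval ![v.1, v.2] f = 0 ∧ ¬ sing w) ∧ red v = w := by
        simp only [Finset.mem_filter, S, Finset.mem_univ, true_and]
        constructor <;> rintro ⟨⟨h1, h2⟩, rfl⟩ <;> exact ⟨⟨h1, h2⟩, rfl⟩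
      by_cases hw : aeval ![w.1, w.2] h₀ = 0
      · refine le_trans ?_ (card_fiber_le_card_ker π w.1)
        refine Finset.card_le_card_of_injOn Prod.fst ?_ ?_
        · intro v hv
          have := ((hmem v).1 hv).2
          simp [← this, red]
        · rintro ⟨x, y⟩ hv ⟨x', y'⟩ hv' (rfl : x = x')
          obtain ⟨⟨h1, h2⟩, rfl⟩ := (hmem _).1 hv
          obtain ⟨⟨h1', -⟩, h3⟩ := (hmem _).1 hv'
          have : y' = y := hf₁ x y y' h1 h1' (hdiff _ _ (congrArg Prod.snd h3).symm)
            (hunit _ (by rw [hπ]; exact fun h => h2 ⟨hw, h⟩))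
          rw [this]
      · refine le_trans ?_ (card_fiber_le_card_ker π w.2)
        refine Finset.card_le_card_of_injOn Prod.snd ?_ ?_
        · intro v hv
          have := ((hmem v).1 hv).2
          simp [← this, red]
        · rintro ⟨x, y⟩ hv ⟨x', y'⟩ hv' (rfl : y = y')
          obtain ⟨⟨h1, h2⟩, rfl⟩ := (hmem _).1 hv
          obtain ⟨⟨h1', -⟩, h3⟩ := (hmem _).1 hv'
          have : x' = x := hf₀ x x' y h1 h1' (hdiff _ _ (congrArg Prod.fst h3).symm)
            (hunit _ (by rw [hπ]; exact hw))
          rw [this]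
  change S.card ≤ _
  omega

/-- The number of invertible matrices with `f (tr g, det g) = 0` is bounded through the number of
zeros of `f`. -/
theorem card_GL_zeros_le [DecidableEq R] (π : R →+* k) (hunit : ∀ x, π x ≠ 0 → IsUnit x)
    (f : MvPolynomial (Fin 2) ℤ) :
    Nat.card {g : GL (Fin 2) R | aeval ![Matrix.trace (g : Matrix (Fin 2) (Fin 2) R),
        Matrix.det (g : Matrix (Fin 2) (Fin 2) R)] f = 0} ≤
      (2 * Fintype.card R + (Finset.univ.filter fun x => π x = 0).card ^ 2) *
      ((Finset.univ.filter fun v : R × R => aeval ![v.1, v.2] f = 0).card * Fintype.card R) := by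
  rw [Nat.card_coe_set_eq, Set.ncard_eq_toFinset_card', ← Finset.card_univ (α := R),
    ← Finset.card_product]
  refine Finset.card_le_mul_card_image_of_maps_to
    (f := fun g : GL (Fin 2) R => ((Matrix.trace (g : Matrix (Fin 2) (Fin 2) R),
        Matrix.det (g : Matrix (Fin 2) (Fin 2) R)), g 0 0)) ?_ _ ?_
  · intro g hg
    simpa using hg
  · rintro ⟨⟨t, d⟩, a⟩ _
    refine le_trans ?_ (card_mul_eq_le π hunit (a * (t - a) - d))
    refine Finset.card_le_card_of_injOn (fun g => (g 0 1, g 1 0)) ?_ ?_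
    · intro g hg
      simp only [Finset.coe_filter, Set.mem_ofPred_eq, Prod.mk.injEq, Matrix.trace_fin_two,
        Matrix.det_fin_two] at hg
      obtain ⟨-, ⟨rfl, rfl⟩, rfl⟩ := hg
      simp only [Finset.coe_filter, Set.mem_ofPred_eq, Finset.mem_univ, true_and]
      ring
    · intro g hg g' hg' h
      simp only [Finset.coe_filter, Set.mem_ofPred_eq, Prod.mk.injEq, Matrix.trace_fin_two] at hg hg'
      simp only [Prod.mk.injEq] at h
      obtain ⟨-, ⟨h1, -⟩, h2⟩ := hg
      obtain ⟨-, ⟨h1', -⟩, h2'⟩ := hg'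
      ext i j
      fin_cases i <;> fin_cases j
      · exact h2.trans h2'.symm
      · exact h.1
      · exact h.2
      · show g 1 1 = g' 1 1
        linear_combination h1 - h1' - h2 + h2'

theorem card_units_sq_mul_card_sq_le_card_GL :
    Nat.card Rˣ ^ 2 * Nat.card R ^ 2 ≤ Nat.card (GL (Fin 2) R) := by
  have : Nat.card ((Rˣ × Rˣ) × (R × R)) = Nat.card Rˣ ^ 2 * Nat.card R ^ 2 := by
    simp only [Nat.card_prod, sq]
  rw [← this]
  let φ : (Rˣ × Rˣ) × (R × R) → GL (Fin 2) R := fun v =>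
    Matrix.GeneralLinearGroup.mk'' !![(v.1.1 : R), v.2.1; v.2.2, ↑v.1.1⁻¹ * (v.1.2 + v.2.1 * v.2.2)]
      (by
        rw [Matrix.det_fin_two_of, Units.mul_inv_cancel_left, add_sub_cancel_right]
        exact v.1.2.isUnit)
  refine Nat.card_le_card_of_injective φ ?_
  rintro ⟨⟨a, d⟩, b, c⟩ ⟨⟨a', d'⟩, b', c'⟩ h
  have hm : ∀ i j, (φ ⟨⟨a, d⟩, b, c⟩) i j = (φ ⟨⟨a', d'⟩, b', c'⟩) i j := by simp [h]
  have h00 : (a : R) = a' := hm 0 0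
  have h01 : b = b' := hm 0 1
  have h10 : c = c' := hm 1 0
  have h11 : ↑a⁻¹ * (d + b * c) = ↑a'⁻¹ * (d' + b' * c') := hm 1 1
  obtain rfl := Units.ext h00
  subst h01 h10
  have : d = d' := Units.ext (add_right_cancel (a⁻¹.isUnit.mul_left_cancel h11))
  rw [this]

end Counting

section ZModPrimeSquare

variable (p : ℕ) [hp : Fact p.Prime]

/-- The reduction map `ℤ/p²ℤ → ℤ/pℤ`. -/
abbrev zmodSqReduction : ZMod (p ^ 2) →+* ZMod p :=
  ZMod.castHom (Dvd.intro_left p (sq p).symm) (ZMod p)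

variable {p}

theorem zmodSqReduction_eq_zero_iff (x : ZMod (p ^ 2)) :
    zmodSqReduction p x = 0 ↔ p ∣ x.val := by
  have : NeZero (p ^ 2) := ⟨pow_ne_zero _ hp.out.ne_zero⟩
  conv_lhs => rw [← ZMod.natCast_zmod_val x]
  rw [map_natCast, ZMod.natCast_eq_zero_iff]

theorem isUnit_iff_zmodSqReduction_ne_zero (x : ZMod (p ^ 2)) :
    IsUnit x ↔ zmodSqReduction p x ≠ 0 := by
  have : NeZero (p ^ 2) := ⟨pow_ne_zero _ hp.out.ne_zero⟩
  rw [Ne, zmodSqReduction_eq_zero_iff, ← ZMod.natCast_zmod_val x, ZMod.isUnit_iff_coprime,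
    Nat.coprime_pow_right_iff two_pos, Nat.coprime_comm, hp.out.coprime_iff_not_dvd,
    ZMod.natCast_zmod_val]

theorem sq_eq_zero_of_zmodSqReduction_eq_zero (x : ZMod (p ^ 2)) (hx : zmodSqReduction p x = 0) :
    x ^ 2 = 0 := by
  have : NeZero (p ^ 2) := ⟨pow_ne_zero _ hp.out.ne_zero⟩
  rw [zmodSqReduction_eq_zero_iff] at hx
  rw [← ZMod.natCast_zmod_val x, ← Nat.cast_pow, ZMod.natCast_eq_zero_iff]
  exact pow_dvd_pow_of_dvd hx 2

theorem card_units_zmodSq : Nat.card (ZMod (p ^ 2))ˣ = p * (p - 1) := by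
  have : NeZero (p ^ 2) := ⟨pow_ne_zero _ hp.out.ne_zero⟩
  rw [Nat.card_eq_fintype_card, ZMod.card_units_eq_totient, Nat.totient_prime_pow hp.out two_pos,
    show 2 - 1 = 1 from rfl, pow_one]

theorem card_ker_zmodSqReduction :
    (Finset.univ.filter fun x => zmodSqReduction p x = 0).card = p := by
  have : NeZero (p ^ 2) := ⟨pow_ne_zero _ hp.out.ne_zero⟩
  have hsum := Finset.card_filter_add_card_filter_not (s := Finset.univ)
    (fun x => zmodSqReduction p x = 0)
  have hunits : (Finset.univ.filter fun x => ¬ zmodSqReduction p x = 0).card = p * (p - 1) := by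
    rw [← card_units_zmodSq,
      Nat.card_congr (Submonoid.unitsTypeEquivIsUnitSubmonoid (M := ZMod (p ^ 2))).toEquiv]
    refine (Nat.subtype_card _ fun x => ?_).symm
    rw [IsUnit.mem_submonoid_iff, isUnit_iff_zmodSqReduction_ne_zero, Finset.mem_filter]
    exact and_iff_right (Finset.mem_univ x)
  rw [hunits, Finset.card_univ, ZMod.card] at hsum
  obtain ⟨q, hq⟩ := Nat.exists_eq_succ_of_ne_zero hp.out.ne_zero
  have : p ^ 2 = p + p * (p - 1) := by
    rw [hq, Nat.succ_sub_one, Nat.succ_eq_add_one]; ring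
  omega

end ZModPrimeSquare

/-- The proportion of `GL₂(ℤ/nℤ)` lying in `C_f(n)`. -/
noncomputable def density (f : MvPolynomial (Fin 2) ℤ) (n : ℕ) : ℝ :=
  (Nat.card (Cf f n) : ℝ) / (Nat.card (GL (Fin 2) (ZMod n)) : ℝ)

theorem density_nonneg (f : MvPolynomial (Fin 2) ℤ) (n : ℕ) : 0 ≤ density f n := by
  unfold density
  positivity

theorem density_le_one (f : MvPolynomial (Fin 2) ℤ) (n : ℕ) [NeZero n] : density f n ≤ 1 := by
  refine div_le_one_of_le₀ ?_ (Nat.cast_nonneg _)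
  exact_mod_cast Nat.card_le_card_of_injective _ (Subtype.val_injective (p := (· ∈ Cf f n)))

theorem density_one (f : MvPolynomial (Fin 2) ℤ) : density f 1 = 1 := by
  have : Cf f 1 = Set.univ := Set.eq_univ_of_forall fun g => Subsingleton.elim (α := ZMod 1) _ _
  rw [density, this, Nat.card_univ, div_self]
  exact_mod_cast Nat.card_pos.ne'

theorem exists_card_zeros_zmodSq_le (f : MvPolynomial (Fin 2) ℤ) (hf : Squarefree f) :
    ∃ C P : ℕ, ∀ p : ℕ, [Fact p.Prime] → P < p →
      (Finset.univ.filter fun v : ZMod (p ^ 2) × ZMod (p ^ 2) =>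
        aeval ![v.1, v.2] f = 0).card ≤ C * p ^ 2 := by
  obtain ⟨h₀, D₀, hD₀, hcommon₀, hrigid₀⟩ := exists_partial_derivative f hf
  obtain ⟨h₁, D₁, hD₁, hcommon₁, hrigid₁⟩ := exists_partial_derivative _
    (squarefree_mulEquiv (renameEquiv ℤ (Equiv.swap (0 : Fin 2) 1)) hf)
  simp only [renameEquiv_apply, aeval_rename_swap] at hcommon₁ hrigid₁
  obtain ⟨C, P, hC⟩ := exists_card_zeros_mod_prime_le f hf.ne_zero
  obtain ⟨C₀, P₀, hC₀⟩ := exists_card_zeros_mod_prime_le D₀ hD₀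
  obtain ⟨C₁, P₁, hC₁⟩ := exists_card_zeros_mod_prime_le D₁ hD₁
  refine ⟨C + C₁ * C₀, max P (max P₀ P₁), fun p hp hlt => ?_⟩
  have hp0 := hp.out.pos
  have : NeZero (p ^ 2) := ⟨pow_ne_zero _ hp.out.ne_zero⟩
  simp only [max_lt_iff] at hlt
  specialize hC p hp.out hlt.1
  specialize hC₀ p hp.out hlt.2.1
  specialize hC₁ p hp.out hlt.2.2
  rw [pow_one] at hC₀ hC₁
  rw [sq, ← mul_assoc] at hC
  replace hC := Nat.le_of_mul_le_mul_right hC hp0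
  replace hC₀ := Nat.le_of_mul_le_mul_right hC₀ hp0
  replace hC₁ := Nat.le_of_mul_le_mul_right hC₁ hp0
  have hpair : (Finset.univ.filter fun v : ZMod p × ZMod p => aeval ![v.1, v.2] f = 0).card =
      Nat.card {v : Fin 2 → ZMod p // aeval v f = 0} := by
    rw [← Nat.subtype_card (p := fun v : ZMod p × ZMod p => aeval ![v.1, v.2] f = 0) _
      (by simp)]
    exact Nat.card_congr ((finTwoArrowEquiv (ZMod p)).symm.subtypeEquiv fun v => Iff.rfl)
  have hsingle (D : MvPolynomial (Fin 1) ℤ) :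
      (Finset.univ.filter fun y : ZMod p => aeval ![y] D = 0).card =
        Nat.card {v : Fin 1 → ZMod p // aeval v D = 0} := by
    rw [← Nat.subtype_card (p := fun y : ZMod p => aeval ![y] D = 0) _ (by simp)]
    refine Nat.card_congr ((Equiv.funUnique (Fin 1) (ZMod p)).symm.subtypeEquiv fun v => ?_)
    rw [show ![v] = (Equiv.funUnique (Fin 1) (ZMod p)).symm v by ext i; fin_cases i; rfl]
  have hmain := card_zeros_le (zmodSqReduction p)
    (fun x => (isUnit_iff_zmodSqReduction_ne_zero x).2) sq_eq_zero_of_zmodSqReduction_eq_zero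
    f h₀ (rename (Equiv.swap 0 1) h₁) (hrigid₀ _)
    (fun x y y' a b c d => hrigid₁ _ y y' x a b c (by rwa [aeval_rename_swap] at d))
  have hsing : (Finset.univ.filter fun v : ZMod p × ZMod p => aeval ![v.1, v.2] f = 0 ∧
      aeval ![v.1, v.2] h₀ = 0 ∧ aeval ![v.1, v.2] (rename (Equiv.swap 0 1) h₁) = 0).card ≤
      C₁ * C₀ := by
    refine le_trans (Finset.card_le_card
      (t := (Finset.univ.filter fun x => aeval ![x] D₁ = 0) ×ˢ
        (Finset.univ.filter fun y => aeval ![y] D₀ = 0)) ?_) ?_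
    · intro v hv
      simp only [Finset.mem_filter, Finset.mem_univ, true_and, aeval_rename_swap] at hv
      simp only [Finset.mem_filter, Finset.mem_univ, true_and, Finset.mem_product]
      exact ⟨hcommon₁ _ v.2 v.1 hv.1 hv.2.2, hcommon₀ _ v.1 v.2 hv.1 hv.2.1⟩
    · rw [Finset.card_product, hsingle, hsingle]
      exact Nat.mul_le_mul hC₁ hC₀
  rw [card_ker_zmodSqReduction, hpair] at hmain
  calc _ ≤ _ := hmain
    _ ≤ p * (C * p) + p ^ 2 * (C₁ * C₀) := by gcongr
    _ = _ := by ring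

theorem exists_density_prime_sq_le (f : MvPolynomial (Fin 2) ℤ) (hf : Squarefree f) :
    ∃ C : ℝ, ∀ p : ℕ, p.Prime → density f (p ^ 2) ≤ C / (p : ℝ) ^ 2 := by
  obtain ⟨C, P, hC⟩ := exists_card_zeros_zmodSq_le f hf
  refine ⟨max (12 * C) (P ^ 2), fun p hp => ?_⟩
  have := Fact.mk hp
  have : NeZero (p ^ 2) := ⟨pow_ne_zero _ hp.ne_zero⟩
  have hp2 : (2 : ℝ) ≤ p := by exact_mod_cast hp.two_le
  have hp0 : (0 : ℝ) < p := by linarith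
  rcases le_or_gt p P with hle | hlt
  · refine (density_le_one f _).trans ?_
    rw [one_le_div (by positivity)]
    have : (p : ℝ) ≤ P := by exact_mod_cast hle
    exact le_max_of_le_right (by gcongr)
  · have hnum : Nat.card (Cf f (p ^ 2)) ≤ 3 * C * p ^ 6 := by
      have := card_GL_zeros_le (zmodSqReduction p)
        (fun x => (isUnit_iff_zmodSqReduction_ne_zero x).2) f
      rw [card_ker_zmodSqReduction, ZMod.card] at this
      calc _ ≤ _ := this
        _ ≤ (2 * p ^ 2 + p ^ 2) * ((C * p ^ 2) * p ^ 2) := by gcongr; exact hC p hlt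
        _ = _ := by ring
    have hden : ((p : ℝ) * (p - 1)) ^ 2 * ((p : ℝ) ^ 2) ^ 2 ≤
        Nat.card (GL (Fin 2) (ZMod (p ^ 2))) := by
      have := card_units_sq_mul_card_sq_le_card_GL (R := ZMod (p ^ 2))
      rw [card_units_zmodSq, Nat.card_zmod] at this
      rw [← Nat.cast_pred hp.pos]
      exact_mod_cast this
    have hden' : (p : ℝ) ^ 8 / 4 ≤ Nat.card (GL (Fin 2) (ZMod (p ^ 2))) := by
      refine le_trans ?_ hden
      calc (p : ℝ) ^ 8 / 4 = (p * (p / 2)) ^ 2 * ((p : ℝ) ^ 2) ^ 2 := by ring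
        _ ≤ _ := by gcongr; linarith
    have hnum' : (Nat.card (Cf f (p ^ 2)) : ℝ) ≤ 3 * C * (p : ℝ) ^ 6 := by exact_mod_cast hnum
    calc density f (p ^ 2) ≤ (3 * C * (p : ℝ) ^ 6) / ((p : ℝ) ^ 8 / 4) := by
          unfold density
          gcongr
      _ = 12 * C / (p : ℝ) ^ 2 := by field_simp; ring
      _ ≤ _ := by gcongr; exact le_max_left _ _

section ChineseRemainder

variable {A B C : Type*} [CommRing A] [CommRing B] [CommRing C]

/-- `GL₂` of a product of rings is the product of the `GL₂`s. -/
noncomputable def glProdEquiv (e : A ≃+* B × C) :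
    GL (Fin 2) A ≃* GL (Fin 2) B × GL (Fin 2) C :=
  (Units.mapEquiv (RingEquiv.ofBijective
    (((RingHom.fst B C).comp (e : A →+* B × C)).mapMatrix.prod
      ((RingHom.snd B C).comp (e : A →+* B × C)).mapMatrix :
        Matrix (Fin 2) (Fin 2) A →+* Matrix (Fin 2) (Fin 2) B × Matrix (Fin 2) (Fin 2) C)
    ⟨fun M N h => by
      ext i j
      apply e.injective
      exact Prod.ext (congrFun (congrFun (congrArg Prod.fst h) i) j)
        (congrFun (congrFun (congrArg Prod.snd h) i) j),
    fun M => ⟨Matrix.of fun i j => e.symm (M.1 i j, M.2 i j), by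
      ext i j <;> simp⟩⟩).toMulEquiv).trans MulEquiv.prodUnits

theorem coe_glProdEquiv_fst (e : A ≃+* B × C) (g : GL (Fin 2) A) :
    ((glProdEquiv e g).1 : Matrix (Fin 2) (Fin 2) B) =
      ((RingHom.fst B C).comp (e : A →+* B × C)).mapMatrix (g : Matrix (Fin 2) (Fin 2) A) := rfl

theorem coe_glProdEquiv_snd (e : A ≃+* B × C) (g : GL (Fin 2) A) :
    ((glProdEquiv e g).2 : Matrix (Fin 2) (Fin 2) C) =
      ((RingHom.snd B C).comp (e : A →+* B × C)).mapMatrix (g : Matrix (Fin 2) (Fin 2) A) := rfl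

theorem aeval_trace_det_mapMatrix (φ : A →+* B) (M : Matrix (Fin 2) (Fin 2) A)
    (f : MvPolynomial (Fin 2) ℤ) :
    aeval ![(φ.mapMatrix M).trace, (φ.mapMatrix M).det] f = φ (aeval ![M.trace, M.det] f) := by
  rw [map_aeval_pair, RingHom.map_det]
  simp [Matrix.trace_fin_two]

end ChineseRemainder

theorem density_mul (f : MvPolynomial (Fin 2) ℤ) {m n : ℕ} (h : m.Coprime n) :
    density f (m * n) = density f m * density f n := by
  let e := ZMod.chineseRemainder h
  have hmem (g : GL (Fin 2) (ZMod (m * n))) :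
      g ∈ Cf f (m * n) ↔ (glProdEquiv e g).1 ∈ Cf f m ∧ (glProdEquiv e g).2 ∈ Cf f n := by
    simp only [Cf, Set.mem_ofPred_eq, coe_glProdEquiv_fst, coe_glProdEquiv_snd,
      aeval_trace_det_mapMatrix]
    rw [← map_eq_zero_iff e e.injective, Prod.ext_iff]
    rfl
  have hCf : Nat.card (Cf f (m * n)) = Nat.card (Cf f m) * Nat.card (Cf f n) := by
    rw [← Nat.card_prod]
    exact Nat.card_congr (((glProdEquiv e).toEquiv.subtypeEquiv hmem).trans
      Equiv.subtypeProdEquivProd)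
  have hGL : Nat.card (GL (Fin 2) (ZMod (m * n))) =
      Nat.card (GL (Fin 2) (ZMod m)) * Nat.card (GL (Fin 2) (ZMod n)) := by
    rw [← Nat.card_prod]
    exact Nat.card_congr (glProdEquiv e).toEquiv
  rw [density, hCf, hGL, Nat.cast_mul, Nat.cast_mul, mul_div_mul_comm]
  rfl

theorem density_sq_eq_prod_primeFactors (f : MvPolynomial (Fin 2) ℤ) {n : ℕ}
    (hn : Squarefree n) : density f (n ^ 2) = ∏ p ∈ n.primeFactors, density f (p ^ 2) := by
  rw [Nat.multiplicative_factorization (fun n => density f (n ^ 2))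
    (fun x y hxy => by rw [mul_pow, density_mul f (hxy.pow 2 2)])
    (by rw [one_pow, density_one]) hn.ne_zero, Finsupp.prod, Nat.support_factorization]
  refine Finset.prod_congr rfl fun p hp => ?_
  rw [Nat.factorization_eq_one_of_squarefree hn (Nat.prime_of_mem_primeFactors hp)
    (Nat.dvd_of_mem_primeFactors hp), pow_one]

theorem stmt_10 (f : MvPolynomial (Fin 2) ℤ) (hsf : Squarefree f)
    (hnc : 1 ≤ f.totalDegree) :
    Summable (fun n : {m : ℕ // Squarefree m} =>
      (Nat.card (Cf f ((n : ℕ) ^ 2)) : ℝ) /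
        (Nat.card (GL (Fin 2) (ZMod ((n : ℕ) ^ 2))) : ℝ)) := by
  obtain ⟨C, hC⟩ := exists_density_prime_sq_le f hsf
  let a : ℕ → ℝ := fun p => if p.Prime then density f (p ^ 2) else 0
  have ha0 : ∀ p, 0 ≤ a p := fun p => by
    by_cases hp : p.Prime <;> simp [a, hp, density_nonneg]
  have ha : Summable a := by
    refine Summable.of_nonneg_of_le ha0 (fun p => ?_)
      ((Real.summable_one_div_nat_pow.2 one_lt_two).mul_left |C|)
    by_cases hp : p.Prime
    · simp only [a, hp, if_true, mul_one_div]
      exact (hC p hp).trans (by gcongr; exact le_abs_self C)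
    · simp only [a, hp, if_false]
      positivity
  have hinj : Function.Injective fun n : {m : ℕ // Squarefree m} => (n : ℕ).primeFactors := by
    intro m n hmn
    apply Subtype.ext
    rw [← Nat.prod_primeFactors_of_squarefree m.2, ← Nat.prod_primeFactors_of_squarefree n.2]
    exact congrArg (fun s : Finset ℕ => ∏ p ∈ s, p) hmn
  refine ((summable_finsetProd_of_summable_nonneg ha0 ha).comp_injective hinj).congr fun n => ?_
  change ∏ p ∈ (n : ℕ).primeFactors, a p = density f ((n : ℕ) ^ 2)
  rw [density_sq_eq_prod_primeFactors f n.2]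
  exact Finset.prod_congr rfl fun p hp => if_pos (Nat.prime_of_mem_primeFactors hp)
end

section
/- Let f(x,y) ∈ ℤ[x,y] be a squarefree, non-constant polynomial in two variables. Then for every ε with 0 < ε < 1 there exists a constant C > 0 (depending only on f and ε) such that for every real z ≥ 1, the tail sum Σ_{n squarefree, n ≥ z} |C_f(n²)| / |GL₂(ℤ/n²ℤ)|, taken over all squarefree positive integers n ≥ z, is at most C / z^{1 − ε}. -/
open Matrix MvPolynomial

/-! ### Elimination of a variable from a squarefree bivariate polynomial -/

section Elimination

open Polynomial in
/-- A consequence of Gauss's lemma: a squarefree polynomial over a GCD domain stays squarefree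
over the fraction field. -/
theorem squarefree_map_fractionRing {A : Type*} [CommRing A] [IsDomain A] [IsGCDMonoid A]
    (K : Type*) [Field K] [Algebra A K] [IsFractionRing A K] {F : A[X]} (hF : Squarefree F) :
    Squarefree (F.map (algebraMap A K)) := by
  let : NormalizedGCDMonoid A := Nonempty.some inferInstance
  have hinj : Function.Injective (algebraMap A K) := IsFractionRing.injective A K
  intro g hg
  have hg0 : g ≠ 0 := by
    rintro rfl
    rw [zero_mul, zero_dvd_iff, Polynomial.map_eq_zero_iff hinj] at hg
    exact hF.ne_zero hg
  set G := IsLocalization.integerNormalization (nonZeroDivisors A) g with hG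
  obtain ⟨c, hc0, hc⟩ := IsLocalization.integerNormalization_spec (nonZeroDivisors A) g
  have hcK : algebraMap A K c ≠ 0 := by
    rw [Ne, map_eq_zero_iff _ hinj]
    exact nonZeroDivisors.ne_zero hc0
  have hdvd : G.primPart.map (algebraMap A K) ∣ g := by
    have h1 : G.primPart.map (algebraMap A K) ∣ G.map (algebraMap A K) :=
      Polynomial.map_dvd _ G.primPart_dvd
    rw [hG, hc, Algebra.smul_def, Polynomial.algebraMap_apply] at h1
    exact (IsUnit.dvd_mul_left (Polynomial.isUnit_C.2 hcK.isUnit)).1 h1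
  have hprim : (G.primPart * G.primPart).IsPrimitive :=
    G.isPrimitive_primPart.mul G.isPrimitive_primPart
  have hdvd2 : G.primPart * G.primPart ∣ F := by
    refine hprim.dvd_of_fraction_map_dvd_fraction_map (K := K) ?_
    rw [Polynomial.map_mul]
    exact (mul_dvd_mul hdvd hdvd).trans hg
  exact isUnit_or_eq_zero_of_isUnit_integerNormalization_primPart hg0 (hF _ hdvd2)

open Polynomial in
/-- A squarefree polynomial over a GCD domain of characteristic zero and its derivative generate
an ideal containing a nonzero constant. -/
theorem exists_mul_add_mul_derivative_eq_C {A : Type*} [CommRing A] [IsDomain A] [IsGCDMonoid A]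
    [CharZero A] {F : A[X]} (hF : Squarefree F) :
    ∃ (R : A) (U V : A[X]), R ≠ 0 ∧ U * F + V * derivative F = Polynomial.C R := by
  let K := FractionRing A
  have hinj : Function.Injective (algebraMap A K) := IsFractionRing.injective A K
  have : CharZero K := charZero_of_injective_algebraMap hinj
  obtain ⟨u, v, huv⟩ :=
    PerfectField.separable_iff_squarefree.2 (squarefree_map_fractionRing K hF)
  obtain ⟨b, hb0, hb⟩ := IsLocalization.integerNormalization_spec (nonZeroDivisors A) u
  obtain ⟨c, hc0, hc⟩ := IsLocalization.integerNormalization_spec (nonZeroDivisors A) v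
  set U := IsLocalization.integerNormalization (nonZeroDivisors A) u
  set V := IsLocalization.integerNormalization (nonZeroDivisors A) v
  refine ⟨b * c, Polynomial.C c * U, Polynomial.C b * V,
    mul_ne_zero (nonZeroDivisors.ne_zero hb0) (nonZeroDivisors.ne_zero hc0), ?_⟩
  apply Polynomial.map_injective _ hinj
  rw [Algebra.smul_def, Polynomial.algebraMap_apply] at hb hc
  rw [Polynomial.derivative_map] at huv
  simp only [Polynomial.map_add, Polynomial.map_mul, Polynomial.map_C, hb, hc, map_mul]
  linear_combination (Polynomial.C (algebraMap A K b) * Polynomial.C (algebraMap A K c)) * huv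

open Polynomial in
/-- Uniqueness of Hensel lifts: over a square-zero extension of a domain, a polynomial generating
a unit constant together with its derivative has at most as many zeros as its degree. -/
theorem card_zeros_le_natDegree_of_squareZero {S k : Type*} [CommRing S] [Fintype S]
    [DecidableEq S] [CommRing k] [IsDomain k] (π : S →+* k) (hπ : ∀ s, π s = 0 → s ^ 2 = 0)
    {q u v : S[X]} {r : S} (hr : IsUnit r) (h : u * q + v * derivative q = Polynomial.C r) :
    (Finset.univ.filter fun y => q.eval y = 0).card ≤ q.natDegree := by
  classical
  have hne : q.map π ≠ 0 := by
    intro h0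
    have h1 := congrArg (Polynomial.map π) h
    rw [Polynomial.map_add, Polynomial.map_mul, Polynomial.map_mul, ← Polynomial.derivative_map,
      h0, Polynomial.map_C] at h1
    simp only [mul_zero, derivative_zero, add_zero] at h1
    exact (hr.map π).ne_zero (Polynomial.C_eq_zero.1 h1.symm)
  calc (Finset.univ.filter fun y => q.eval y = 0).card
      ≤ (q.map π).roots.toFinset.card := by
        refine Finset.card_le_card_of_injOn π ?_ ?_
        · intro y hy
          have hy' : q.eval y = 0 := by simpa using hy
          simp [hne, Polynomial.eval_map_apply, hy']
        · intro y hy z hz hyz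
          have hy' : q.eval y = 0 := by simpa using hy
          have hz' : q.eval z = 0 := by simpa using hz
          have hsq : (z - y) ^ 2 = 0 := hπ _ (by rw [map_sub, hyz, sub_self])
          obtain ⟨t, ht⟩ := q.binomExpansion y (z - y)
          rw [add_sub_cancel, hy', hz', hsq] at ht
          have hr' : v.eval y * (derivative q).eval y = r := by
            simpa [hy'] using congrArg (Polynomial.eval y) h
          have hunit : IsUnit ((derivative q).eval y) := by
            rw [← hr'] at hr
            exact isUnit_of_mul_isUnit_right hr
          have h0 : (derivative q).eval y * (z - y) = 0 := by simpa using ht.symm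
          exact (sub_eq_zero.1 ((hunit.mul_right_eq_zero).1 h0)).symm
    _ ≤ (q.map π).natDegree := (Multiset.toFinset_card_le _).trans (Polynomial.card_roots' _)
    _ ≤ q.natDegree := Polynomial.natDegree_map_le

end Elimination

/-! ### Reduction from `ZMod (p ^ 2)` to `ZMod p` -/

section Reduction

variable {p : ℕ} [Fact p.Prime]

/-- Reduction modulo `p` on `ZMod (p ^ 2)`. -/
def reductionModPrime (p : ℕ) : ZMod (p ^ 2) →+* ZMod p :=
  ZMod.castHom (dvd_pow_self p two_ne_zero) (ZMod p)

theorem reductionModPrime_eq_zero_iff {s : ZMod (p ^ 2)} :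
    reductionModPrime p s = 0 ↔ p ∣ s.val := by
  conv_lhs => rw [← ZMod.natCast_zmod_val s]
  rw [map_natCast, ZMod.natCast_eq_zero_iff]

theorem sq_eq_zero_of_reductionModPrime_eq_zero (s : ZMod (p ^ 2))
    (hs : reductionModPrime p s = 0) : s ^ 2 = 0 := by
  obtain ⟨k, hk⟩ := reductionModPrime_eq_zero_iff.1 hs
  rw [← ZMod.natCast_zmod_val s, ← Nat.cast_pow, ZMod.natCast_eq_zero_iff, hk, mul_pow]
  exact dvd_mul_right _ _

theorem isUnit_of_reductionModPrime_ne_zero {s : ZMod (p ^ 2)}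
    (hs : reductionModPrime p s ≠ 0) : IsUnit s := by
  rw [← ZMod.natCast_zmod_val s, ZMod.isUnit_natCast_iff_not_dvd_pow Fact.out two_pos]
  exact fun h => hs (reductionModPrime_eq_zero_iff.2 h)

theorem card_reductionModPrime_fiber_le (t : ZMod p) :
    (Finset.univ.filter fun x : ZMod (p ^ 2) => reductionModPrime p x = t).card ≤ p := by
  calc _ ≤ (Finset.range p).card := by
        refine Finset.card_le_card_of_injOn (fun x => x.val / p) ?_ ?_
        · intro x _
          have := ZMod.val_lt x
          simp only [Finset.coe_range, Set.mem_Iio]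
          exact Nat.div_lt_of_lt_mul (this.trans_eq (sq p))
        · intro x hx y hy hxy
          have hx' : reductionModPrime p x = t := by simpa using hx
          have hy' : reductionModPrime p y = t := by simpa using hy
          have h : (x.val : ZMod p) = (y.val : ZMod p) := by
            rw [← map_natCast (reductionModPrime p), ← map_natCast (reductionModPrime p),
              ZMod.natCast_zmod_val, ZMod.natCast_zmod_val, hx', hy']
          have hmod : x.val % p = y.val % p := (ZMod.natCast_eq_natCast_iff' _ _ _).1 h
          apply ZMod.val_injective
          rw [← Nat.div_add_mod x.val p, ← Nat.div_add_mod y.val p, hmod]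
          simp only at hxy
          rw [hxy]
    _ = p := Finset.card_range p

/-- The number of pairs in `ZMod (p ^ 2)` with a given product is at most `3 * p ^ 2`. -/
theorem card_mul_eq_le_s11 (e : ZMod (p ^ 2)) :
    (Finset.univ.filter fun bc : ZMod (p ^ 2) × ZMod (p ^ 2) => bc.1 * bc.2 = e).card
      ≤ 3 * p ^ 2 := by
  have hfib : ∀ b : ZMod (p ^ 2),
      (Finset.univ.filter fun c : ZMod (p ^ 2) => b * c = e).card ≤
        1 + (if reductionModPrime p b = 0 then p else 0) + (if b = 0 then p ^ 2 else 0) := by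
    intro b
    by_cases hb0 : b = 0
    · refine (Finset.card_le_univ _).trans ?_
      simp [hb0, ZMod.card]
    by_cases hb : reductionModPrime p b = 0
    · rw [if_pos hb]
      rcases (Finset.univ.filter fun c : ZMod (p ^ 2) => b * c = e).eq_empty_or_nonempty
        with h | ⟨c₀, hc₀⟩
      · simp [h]
      have hc₀' : b * c₀ = e := by simpa using hc₀
      have hsub : (Finset.univ.filter fun c : ZMod (p ^ 2) => b * c = e) ⊆
          Finset.univ.filter fun c => reductionModPrime p c = reductionModPrime p c₀ := by
        intro c hc
        have hc' : b * c = e := by simpa using hc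
        simp only [Finset.mem_filter, Finset.mem_univ, true_and]
        by_contra hne
        rw [← sub_eq_zero, ← map_sub] at hne
        have hu := isUnit_of_reductionModPrime_ne_zero hne
        have h0 : b * (c - c₀) = 0 := by rw [mul_sub, hc', hc₀', sub_self]
        exact hb0 (hu.mul_left_eq_zero.1 h0)
      have := (Finset.card_le_card hsub).trans (card_reductionModPrime_fiber_le _)
      omega
    · have hu := isUnit_of_reductionModPrime_ne_zero hb
      have : (Finset.univ.filter fun c : ZMod (p ^ 2) => b * c = e).card ≤ 1 := by
        rw [Finset.card_le_one]
        intro c hc d hd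
        simp only [Finset.mem_filter, Finset.mem_univ, true_and] at hc hd
        exact hu.mul_left_cancel (hc.trans hd.symm)
      omega
  calc _ = ∑ b : ZMod (p ^ 2), (Finset.univ.filter fun c : ZMod (p ^ 2) => b * c = e).card := by
        simp only [Finset.card_filter, Fintype.sum_prod_type]
    _ ≤ ∑ b : ZMod (p ^ 2), (1 + (if reductionModPrime p b = 0 then p else 0) +
          (if b = 0 then p ^ 2 else 0)) := Finset.sum_le_sum fun b _ => hfib b
    _ = p ^ 2 + (Finset.univ.filter fun b => reductionModPrime p b = 0).card * p + p ^ 2 := by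
        rw [Finset.sum_add_distrib, Finset.sum_add_distrib, ← Finset.sum_filter,
          Finset.sum_const]
        simp [ZMod.card]
    _ ≤ p ^ 2 + p * p + p ^ 2 := by
        gcongr
        exact card_reductionModPrime_fiber_le 0
    _ = 3 * p ^ 2 := by ring

/-- A polynomial that is nonzero modulo `p` takes values divisible by `p` on at most
`p * natDegree` residues modulo `p ^ 2`. -/
theorem card_reductionModPrime_aeval_eq_zero_le {R : Polynomial ℤ}
    (hR : R.map (Int.castRingHom (ZMod p)) ≠ 0) :
    (Finset.univ.filter fun x : ZMod (p ^ 2) =>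
      reductionModPrime p (Polynomial.aeval x R) = 0).card ≤ p * R.natDegree := by
  classical
  set Q := R.map (Int.castRingHom (ZMod p))
  calc _ ≤ p * Q.roots.toFinset.card := by
        refine Finset.card_le_mul_card_image_of_maps_to (f := reductionModPrime p) ?_ p ?_
        · intro x hx
          have hx' : reductionModPrime p (Polynomial.aeval x R) = 0 := by simpa using hx
          rw [Multiset.mem_toFinset, Polynomial.mem_roots hR, Polynomial.IsRoot, ← hx',
            Polynomial.eval_map, Polynomial.aeval_def, Polynomial.hom_eval₂]
          congr 1
          exact RingHom.ext_int _ _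
        · intro t _
          refine (Finset.card_le_card ?_).trans (card_reductionModPrime_fiber_le t)
          intro x hx
          simp only [Finset.mem_filter, Finset.mem_univ, true_and] at hx ⊢
          exact hx.2
    _ ≤ p * R.natDegree := by
        gcongr
        exact (Multiset.toFinset_card_le _).trans
          ((Polynomial.card_roots' _).trans Polynomial.natDegree_map_le)

end Reduction

/-! ### Zeros of a squarefree bivariate polynomial modulo `p ^ 2` -/

section Zeros

/-- Reducing modulo a prime exceeding the leading coefficient does not kill an integer
polynomial. -/
theorem map_castRingHom_ne_zero_of_lt {R : Polynomial ℤ} (hR : R ≠ 0) {p : ℕ}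
    (hp : R.leadingCoeff.natAbs < p) : R.map (Int.castRingHom (ZMod p)) ≠ 0 := by
  intro h
  have h1 := congrArg (fun Q => Polynomial.coeff Q R.natDegree) h
  simp only [Polynomial.coeff_map, Polynomial.coeff_zero, eq_intCast,
    ZMod.intCast_zmod_eq_zero_iff_dvd] at h1
  have h2 := Nat.le_of_dvd (Int.natAbs_pos.2 (Polynomial.leadingCoeff_ne_zero.2 hR))
    (Int.natCast_dvd.1 h1)
  omega

/-- Outside the residues where an auxiliary nonzero polynomial `R` vanishes modulo `p`, the fibres
of the zero set modulo `p ^ 2` of a squarefree bivariate polynomial are bounded by its degree. -/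
theorem exists_card_zeros_fiber_le {F : Polynomial (Polynomial ℤ)} (hF : Squarefree F) :
    ∃ R : Polynomial ℤ, R ≠ 0 ∧ ∀ (p : ℕ) [Fact p.Prime] (x : ZMod (p ^ 2)),
      reductionModPrime p (Polynomial.aeval x R) ≠ 0 →
      (Finset.univ.filter fun y : ZMod (p ^ 2) =>
        (F.map (Polynomial.aeval x : Polynomial ℤ →ₐ[ℤ] ZMod (p ^ 2)).toRingHom).eval y = 0).card
        ≤ F.natDegree := by
  obtain ⟨R, U, V, hR, hUV⟩ := exists_mul_add_mul_derivative_eq_C hF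
  refine ⟨R, hR, fun p _ x hx => ?_⟩
  set φ := (Polynomial.aeval x : Polynomial ℤ →ₐ[ℤ] ZMod (p ^ 2)).toRingHom
  have h : U.map φ * F.map φ + V.map φ * Polynomial.derivative (F.map φ) =
      Polynomial.C (φ R) := by
    rw [Polynomial.derivative_map, ← Polynomial.map_mul, ← Polynomial.map_mul,
      ← Polynomial.map_add, hUV, Polynomial.map_C]
  exact (card_zeros_le_natDegree_of_squareZero (reductionModPrime p)
    sq_eq_zero_of_reductionModPrime_eq_zero (isUnit_of_reductionModPrime_ne_zero hx) h).trans
    Polynomial.natDegree_map_le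

open Polynomial.Bivariate in
theorem eval_map_equivMvPolynomial_symm {k : Type*} [CommRing k] (x y : k)
    (f : MvPolynomial (Fin 2) ℤ) :
    (((equivMvPolynomial ℤ).symm f).map
      (Polynomial.aeval x : Polynomial ℤ →ₐ[ℤ] k).toRingHom).eval y =
      MvPolynomial.aeval ![x, y] f := by
  induction f using MvPolynomial.induction_on with
  | C a => simp
  | add f g hf hg => simp only [map_add, Polynomial.map_add, Polynomial.eval_add, hf, hg]
  | mul_X f i hf =>
    simp only [map_mul, Polynomial.map_mul, Polynomial.eval_mul, hf]
    fin_cases i <;> simp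

open Polynomial.Bivariate in
theorem eval_map_equivMvPolynomial_symm_rename_swap {k : Type*} [CommRing k] (x y : k)
    (f : MvPolynomial (Fin 2) ℤ) :
    (((equivMvPolynomial ℤ).symm (MvPolynomial.rename (Equiv.swap 0 1) f)).map
      (Polynomial.aeval y : Polynomial ℤ →ₐ[ℤ] k).toRingHom).eval x =
      MvPolynomial.aeval ![x, y] f := by
  rw [eval_map_equivMvPolynomial_symm, MvPolynomial.aeval_rename]
  congr 2
  ext i
  fin_cases i <;> simp

theorem squarefree_mulEquiv_apply {M N : Type*} [Monoid M] [Monoid N] (e : M ≃* N) {x : M}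
    (hx : Squarefree x) : Squarefree (e x) := by
  intro y hy
  have h : e.symm y * e.symm y ∣ x := by
    simpa using map_dvd e.symm hy
  simpa using (hx _ h).map e

/-- A squarefree bivariate integer polynomial has `O(p ^ 2)` zeros modulo `p ^ 2`. -/
theorem exists_card_zeros_le {f : MvPolynomial (Fin 2) ℤ} (hf : Squarefree f) :
    ∃ A : ℕ, ∀ (p : ℕ) [Fact p.Prime],
      (Finset.univ.filter fun v : ZMod (p ^ 2) × ZMod (p ^ 2) =>
        MvPolynomial.aeval ![v.1, v.2] f = 0).card ≤ A * p ^ 2 := by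
  classical
  set F := (Polynomial.Bivariate.equivMvPolynomial ℤ).symm f with hF
  set G := (Polynomial.Bivariate.equivMvPolynomial ℤ).symm
    (MvPolynomial.rename (Equiv.swap 0 1) f) with hG
  have hFs : Squarefree F := squarefree_mulEquiv_apply
    (Polynomial.Bivariate.equivMvPolynomial ℤ).symm.toMulEquiv hf
  have hGs : Squarefree G := squarefree_mulEquiv_apply
    ((MvPolynomial.renameEquiv ℤ (Equiv.swap (0 : Fin 2) 1)).trans
      (Polynomial.Bivariate.equivMvPolynomial ℤ).symm).toMulEquiv hf
  obtain ⟨R, hR, hRb⟩ := exists_card_zeros_fiber_le hFs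
  obtain ⟨S, hS, hSb⟩ := exists_card_zeros_fiber_le hGs
  simp only [hF, eval_map_equivMvPolynomial_symm] at hRb
  simp only [hG, eval_map_equivMvPolynomial_symm_rename_swap] at hSb
  set M := max R.leadingCoeff.natAbs S.leadingCoeff.natAbs
  refine ⟨M ^ 2 + (F.natDegree + G.natDegree + R.natDegree * S.natDegree), fun p _ => ?_⟩
  rcases le_or_gt p M with hpM | hpM
  · refine (Finset.card_le_univ _).trans ?_
    rw [Fintype.card_prod, ZMod.card]
    gcongr
    exact (Nat.pow_le_pow_left hpM 2).trans (Nat.le_add_right _ _)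
  have hRp := card_reductionModPrime_aeval_eq_zero_le
    (map_castRingHom_ne_zero_of_lt hR ((le_max_left _ _).trans_lt hpM))
  have hSp := card_reductionModPrime_aeval_eq_zero_le
    (map_castRingHom_ne_zero_of_lt hS ((le_max_right _ _).trans_lt hpM))
  set Z := Finset.univ.filter fun v : ZMod (p ^ 2) × ZMod (p ^ 2) =>
    MvPolynomial.aeval ![v.1, v.2] f = 0 with hZ
  set ZR := Finset.univ.filter fun x : ZMod (p ^ 2) =>
    reductionModPrime p (Polynomial.aeval x R) = 0 with hZR
  set ZS := Finset.univ.filter fun x : ZMod (p ^ 2) =>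
    reductionModPrime p (Polynomial.aeval x S) = 0 with hZS
  have hcover : Z ⊆ (Z.filter fun v => v.1 ∉ ZR) ∪ (Z.filter fun v => v.2 ∉ ZS) ∪ ZR ×ˢ ZS := by
    intro v hv
    simp only [Finset.mem_union, Finset.mem_filter, Finset.mem_product]
    tauto
  have h1 : (Z.filter fun v => v.1 ∉ ZR).card ≤ F.natDegree * p ^ 2 := by
    have := Finset.card_le_mul_card_image_of_maps_to (f := Prod.fst)
      (s := Z.filter fun v => v.1 ∉ ZR) (t := ZRᶜ) (by simp) F.natDegree (by
        intro x hx
        refine le_trans ?_ (hRb p x (by simpa [hZR] using hx))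
        refine Finset.card_le_card_of_injOn Prod.snd ?_ ?_
        · rintro ⟨a, b⟩ hv
          simp only [hZ, Finset.coe_filter, Finset.mem_filter, Finset.mem_univ, true_and,
            Set.mem_ofPred_eq] at hv ⊢
          rw [← hv.2]
          exact hv.1.1
        · rintro ⟨a, b⟩ hv ⟨c, d⟩ hw hbd
          simp only [Finset.coe_filter, Finset.mem_filter, Set.mem_ofPred_eq] at hv hw
          exact Prod.ext (hv.2.trans hw.2.symm) hbd)
    refine this.trans ?_
    gcongr
    exact (Finset.card_le_univ _).trans_eq (ZMod.card _)
  have h2 : (Z.filter fun v => v.2 ∉ ZS).card ≤ G.natDegree * p ^ 2 := by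
    have := Finset.card_le_mul_card_image_of_maps_to (f := Prod.snd)
      (s := Z.filter fun v => v.2 ∉ ZS) (t := ZSᶜ) (by simp) G.natDegree (by
        intro y hy
        refine le_trans ?_ (hSb p y (by simpa [hZS] using hy))
        refine Finset.card_le_card_of_injOn Prod.fst ?_ ?_
        · rintro ⟨a, b⟩ hv
          simp only [hZ, Finset.coe_filter, Finset.mem_filter, Finset.mem_univ, true_and,
            Set.mem_ofPred_eq] at hv ⊢
          rw [← hv.2]
          exact hv.1.1
        · rintro ⟨a, b⟩ hv ⟨c, d⟩ hw hac
          simp only [Finset.coe_filter, Finset.mem_filter, Set.mem_ofPred_eq] at hv hw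
          exact Prod.ext hac (hv.2.trans hw.2.symm))
    refine this.trans ?_
    gcongr
    exact (Finset.card_le_univ _).trans_eq (ZMod.card _)
  calc Z.card ≤ _ := Finset.card_le_card hcover
    _ ≤ (Z.filter fun v => v.1 ∉ ZR).card + (Z.filter fun v => v.2 ∉ ZS).card
        + (ZR ×ˢ ZS).card :=
      (Finset.card_union_le _ _).trans (Nat.add_le_add_right (Finset.card_union_le _ _) _)
    _ ≤ F.natDegree * p ^ 2 + G.natDegree * p ^ 2 + (p * R.natDegree) * (p * S.natDegree) := by
      rw [Finset.card_product]
      gcongr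
    _ = (F.natDegree + G.natDegree + R.natDegree * S.natDegree) * p ^ 2 := by ring
    _ ≤ _ := Nat.mul_le_mul_right _ (Nat.le_add_left _ _)

end Zeros

/-! ### Counting matrices -/

section Matrices

/-- The matrices in `Cf f (p ^ 2)` number at most `3 * p ^ 4` times the zeros of `f` modulo
`p ^ 2`. -/
theorem card_Cf_sq_le {f : MvPolynomial (Fin 2) ℤ} {A p : ℕ} [Fact p.Prime]
    (hA : (Finset.univ.filter fun v : ZMod (p ^ 2) × ZMod (p ^ 2) =>
      MvPolynomial.aeval ![v.1, v.2] f = 0).card ≤ A * p ^ 2) :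
    Nat.card (Cf f (p ^ 2)) ≤ 3 * A * p ^ 6 := by
  classical
  set Z := Finset.univ.filter fun v : ZMod (p ^ 2) × ZMod (p ^ 2) =>
    MvPolynomial.aeval ![v.1, v.2] f = 0 with hZ
  let _ : Fintype (Cf f (p ^ 2)) := Fintype.ofFinite _
  rw [Nat.card_eq_fintype_card, ← Finset.card_univ]
  have key := Finset.card_le_mul_card_image_of_maps_to
    (f := fun g : Cf f (p ^ 2) => ((g.1.1.trace, g.1.1.det), g.1.1 0 0))
    (s := Finset.univ) (t := Z ×ˢ Finset.univ) (by
      intro g _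
      simpa [hZ, Cf] using g.2) (3 * p ^ 2) (by
      rintro ⟨⟨t, d⟩, a⟩ _
      refine le_trans ?_ (card_mul_eq_le_s11 (a * (t - a) - d))
      have hentry : ∀ g : Cf f (p ^ 2),
          ((g.1.1.trace, g.1.1.det), g.1.1 0 0) = ((t, d), a) →
          g.1.1 0 0 = a ∧ g.1.1 1 1 = t - a ∧ g.1.1 0 1 * g.1.1 1 0 = a * (t - a) - d := by
        intro g hg
        simp only [Prod.mk.injEq, Matrix.trace_fin_two, Matrix.det_fin_two] at hg
        obtain ⟨⟨ht, hd⟩, ha⟩ := hg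
        have h11 : g.1.1 1 1 = t - a := by rw [← ht, ← ha]; ring
        refine ⟨ha, h11, ?_⟩
        rw [← hd, ← h11, ← ha]
        ring
      refine Finset.card_le_card_of_injOn (fun g => (g.1.1 0 1, g.1.1 1 0)) ?_ ?_
      · intro g hg
        have hg' := (hentry g (by simpa using hg)).2.2
        simpa using hg'
      · intro g hg h hh hgh
        obtain ⟨g1, g2, -⟩ := hentry g (by simpa using hg)
        obtain ⟨h1, h2, -⟩ := hentry h (by simpa using hh)
        simp only [Prod.mk.injEq] at hgh
        apply Subtype.ext
        apply Units.ext
        ext i j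
        fin_cases i <;> fin_cases j
        · exact g1.trans h1.symm
        · exact hgh.1
        · exact hgh.2
        · exact g2.trans h2.symm)
  refine key.trans ?_
  rw [Finset.card_product, Finset.card_univ, ZMod.card]
  calc 3 * p ^ 2 * (Z.card * p ^ 2) ≤ 3 * p ^ 2 * (A * p ^ 2 * p ^ 2) := by gcongr
    _ = 3 * A * p ^ 6 := by ring

theorem map_mem_Cf {f : MvPolynomial (Fin 2) ℤ} {m n : ℕ} (φ : ZMod n →+* ZMod m)
    {g : GL (Fin 2) (ZMod n)} (hg : g ∈ Cf f n) :
    Matrix.GeneralLinearGroup.map φ g ∈ Cf f m := by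
  have hg' : MvPolynomial.aeval ![g.1.trace, g.1.det] f = 0 := hg
  have h := congrArg φ hg'
  rw [map_zero, MvPolynomial.aeval_def, MvPolynomial.eval₂_comp_left] at h
  change MvPolynomial.aeval ![Matrix.trace (g.1.map φ), Matrix.det (g.1.map φ)] f = 0
  rw [← h, MvPolynomial.aeval_def]
  congr 1
  · exact RingHom.ext_int _ _
  · ext i
    fin_cases i
    · simp [Matrix.trace_fin_two]
    · simp [Matrix.det_fin_two]

theorem card_Cf_mul_le (f : MvPolynomial (Fin 2) ℤ) {m n : ℕ} [NeZero m] [NeZero n]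
    (hmn : m.Coprime n) :
    Nat.card (Cf f (m * n)) ≤ Nat.card (Cf f m) * Nat.card (Cf f n) := by
  rw [← Nat.card_prod]
  let φ := ZMod.castHom (dvd_mul_right m n) (ZMod m)
  let ψ := ZMod.castHom (dvd_mul_left n m) (ZMod n)
  have hinj : ∀ a b : ZMod (m * n), φ a = φ b → ψ a = ψ b → a = b := by
    intro a b h1 h2
    apply (ZMod.chineseRemainder hmn).injective
    have e1 : ∀ c, (ZMod.chineseRemainder hmn c).1 = φ c := fun c => RingHom.congr_fun
      (RingHom.ext_zmod ((RingHom.fst _ _).comp (ZMod.chineseRemainder hmn).toRingHom) φ) c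
    have e2 : ∀ c, (ZMod.chineseRemainder hmn c).2 = ψ c := fun c => RingHom.congr_fun
      (RingHom.ext_zmod ((RingHom.snd _ _).comp (ZMod.chineseRemainder hmn).toRingHom) ψ) c
    exact Prod.ext (by rw [e1, e1, h1]) (by rw [e2, e2, h2])
  refine Nat.card_le_card_of_injective
    (fun g => ((⟨_, map_mem_Cf φ g.2⟩, ⟨_, map_mem_Cf ψ g.2⟩) : Cf f m × Cf f n)) ?_
  intro g h hgh
  simp only [Prod.mk.injEq, Subtype.mk.injEq] at hgh
  apply Subtype.ext
  apply Units.ext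
  ext i j
  exact hinj _ _ (congrArg (fun g : GL (Fin 2) (ZMod m) => g.1 i j) hgh.1)
    (congrArg (fun g : GL (Fin 2) (ZMod n) => g.1 i j) hgh.2)

/-- Matrices with a unit in the upper left corner give a lower bound for `|GL₂(ℤ/Nℤ)|`. -/
theorem totient_sq_mul_sq_le_card_GL (N : ℕ) [NeZero N] :
    N.totient ^ 2 * N ^ 2 ≤ Nat.card (GL (Fin 2) (ZMod N)) := by
  let R := ZMod N
  have hdet : ∀ w : (Rˣ × Rˣ) × (R × R),
      (!![(w.1.1 : R), w.2.1; w.2.2, (w.1.1⁻¹ : Rˣ) * (w.1.2 + w.2.1 * w.2.2)]).det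
        = w.1.2 := by
    intro w
    rw [Matrix.det_fin_two_of, ← mul_assoc, Units.mul_inv]
    ring
  let F : (Rˣ × Rˣ) × (R × R) → GL (Fin 2) R := fun w =>
    Matrix.GeneralLinearGroup.mk'' _ (by rw [hdet w]; exact w.1.2.isUnit)
  have hF : Function.Injective F := by
    intro w w' h
    have hval := congrArg (fun g : GL (Fin 2) R => g.1) h
    have h00 : (w.1.1 : R) = w'.1.1 := congrFun (congrFun hval 0) 0
    have h01 : w.2.1 = w'.2.1 := congrFun (congrFun hval 0) 1
    have h10 : w.2.2 = w'.2.2 := congrFun (congrFun hval 1) 0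
    have hd : (w.1.2 : R) = w'.1.2 := by
      rw [← hdet w, ← hdet w']
      exact congrArg Matrix.det hval
    exact Prod.ext (Prod.ext (Units.ext h00) (Units.ext hd)) (Prod.ext h01 h10)
  have := Nat.card_le_card_of_injective F hF
  simpa [R, Nat.card_prod, Nat.card_eq_fintype_card, ZMod.card_units_eq_totient, ZMod.card,
    sq] using this

end Matrices

/-! ### The density for squarefree moduli and the tail sum -/

section Tail

theorem card_Cf_prod_sq_le {f : MvPolynomial (Fin 2) ℤ} {B : ℕ}
    (hB : ∀ p : ℕ, p.Prime → Nat.card (Cf f (p ^ 2)) ≤ B * p ^ 6) (s : Finset ℕ)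
    (hs : ∀ p ∈ s, p.Prime) :
    Nat.card (Cf f ((∏ p ∈ s, p) ^ 2)) ≤ B ^ s.card * (∏ p ∈ s, p) ^ 6 := by
  induction s using Finset.induction_on with
  | empty =>
    have : Subsingleton (Cf f 1) := by
      refine ⟨fun g h => Subtype.ext (Units.ext ?_)⟩
      ext i j
      exact Subsingleton.elim (α := ZMod 1) _ _
    rw [Finset.prod_empty, Finset.card_empty, pow_zero, one_pow, one_pow, one_mul]
    exact Finite.card_le_one_iff_subsingleton.2 this
  | insert q s hq ih =>
    have hqp : q.Prime := hs q (Finset.mem_insert_self _ _)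
    have hs' : ∀ p ∈ s, p.Prime := fun p hp => hs p (Finset.mem_insert_of_mem hp)
    rw [Finset.prod_insert hq, Finset.card_insert_of_notMem hq, mul_pow q _ 2]
    have hcop : (q ^ 2).Coprime ((∏ p ∈ s, p) ^ 2) := by
      refine Nat.Coprime.pow 2 2 (Nat.Coprime.prod_right fun p hp => ?_)
      exact (Nat.coprime_primes hqp (hs' p hp)).2 fun h => hq (h ▸ hp)
    have : NeZero (q ^ 2) := ⟨pow_ne_zero 2 hqp.ne_zero⟩
    have : NeZero ((∏ p ∈ s, p) ^ 2) :=
      ⟨pow_ne_zero 2 (Finset.prod_ne_zero_iff.2 fun p hp => (hs' p hp).ne_zero)⟩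
    calc _ ≤ Nat.card (Cf f (q ^ 2)) * Nat.card (Cf f ((∏ p ∈ s, p) ^ 2)) :=
          card_Cf_mul_le f hcop
      _ ≤ (B * q ^ 6) * (B ^ s.card * (∏ p ∈ s, p) ^ 6) := by
          gcongr
          · exact hB q hqp
          · exact ih hs'
      _ = _ := by ring

theorem le_two_pow_mul_totient (n : ℕ) : n ≤ 2 ^ n.primeFactors.card * n.totient := by
  have h : (n : ℚ) ≤ 2 ^ n.primeFactors.card * (n.totient : ℚ) := by
    rw [Nat.totient_eq_mul_prod_factors, mul_left_comm, ← Finset.prod_const,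
      ← Finset.prod_mul_distrib]
    refine le_mul_of_one_le_right (Nat.cast_nonneg n) (Finset.one_le_prod fun p hp => ?_)
    have hp2 : (2 : ℚ) ≤ p := by exact_mod_cast (Nat.prime_of_mem_primeFactors hp).two_le
    have : (p : ℚ)⁻¹ ≤ 2⁻¹ := by gcongr
    linarith
  exact_mod_cast h

theorem card_Cf_sq_div_card_GL_le {f : MvPolynomial (Fin 2) ℤ} {B : ℕ}
    (hB : ∀ p : ℕ, p.Prime → Nat.card (Cf f (p ^ 2)) ≤ B * p ^ 6) {n : ℕ}
    (hn : Squarefree n) :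
    (Nat.card (Cf f (n ^ 2)) : ℝ) / (Nat.card (GL (Fin 2) (ZMod (n ^ 2))) : ℝ) ≤
      (4 * B : ℝ) ^ n.primeFactors.card / (n : ℝ) ^ 2 := by
  have hn0 : n ≠ 0 := hn.ne_zero
  have : NeZero (n ^ 2) := ⟨pow_ne_zero 2 hn0⟩
  set w := n.primeFactors.card
  have h1 : Nat.card (Cf f (n ^ 2)) ≤ B ^ w * n ^ 6 := by
    have := card_Cf_prod_sq_le hB n.primeFactors fun p => Nat.prime_of_mem_primeFactors
    rwa [Nat.prod_primeFactors_of_squarefree hn] at this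
  have h2 : n ^ 8 ≤ 4 ^ w * Nat.card (GL (Fin 2) (ZMod (n ^ 2))) := by
    have ht := le_two_pow_mul_totient (n ^ 2)
    rw [Nat.primeFactors_pow n two_ne_zero] at ht
    calc n ^ 8 = (n ^ 2) ^ 2 * (n ^ 2) ^ 2 := by ring
      _ ≤ (2 ^ w * (n ^ 2).totient) ^ 2 * (n ^ 2) ^ 2 := by gcongr
      _ = 4 ^ w * ((n ^ 2).totient ^ 2 * (n ^ 2) ^ 2) := by
          rw [mul_pow, ← pow_mul, mul_comm w 2, pow_mul]; ring
      _ ≤ _ := Nat.mul_le_mul_left _ (totient_sq_mul_sq_le_card_GL (n ^ 2))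
  have h1' : (Nat.card (Cf f (n ^ 2)) : ℝ) ≤ B ^ w * n ^ 6 := by exact_mod_cast h1
  have h2' : (n : ℝ) ^ 8 ≤ 4 ^ w * Nat.card (GL (Fin 2) (ZMod (n ^ 2))) := by exact_mod_cast h2
  have hGL : (0 : ℝ) < Nat.card (GL (Fin 2) (ZMod (n ^ 2))) := by
    exact_mod_cast Nat.card_pos
  have hnpos : (0 : ℝ) < n := by exact_mod_cast Nat.pos_of_ne_zero hn0
  rw [div_le_div_iff₀ hGL (by positivity)]
  calc (Nat.card (Cf f (n ^ 2)) : ℝ) * (n : ℝ) ^ 2 ≤ B ^ w * n ^ 6 * (n : ℝ) ^ 2 := by gcongr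
    _ = B ^ w * (n : ℝ) ^ 8 := by ring
    _ ≤ B ^ w * (4 ^ w * Nat.card (GL (Fin 2) (ZMod (n ^ 2)))) := by gcongr
    _ = _ := by rw [mul_pow]; ring

/-- For squarefree `n` the function `B ^ ω(n)` is `O(n ^ δ)`. -/
theorem exists_pow_card_primeFactors_le {B δ : ℝ} (hB : 1 ≤ B) (hδ : 0 < δ) :
    ∃ D : ℝ, 0 < D ∧ ∀ n : ℕ, Squarefree n → B ^ n.primeFactors.card ≤ D * (n : ℝ) ^ δ := by
  have hB0 : 0 < B := one_pos.trans_le hB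
  set T := ⌈B ^ (1 / δ)⌉₊ with hT
  refine ⟨B ^ T, pow_pos hB0 T, fun n hn => ?_⟩
  have hterm : ∀ p ∈ n.primeFactors, B ≤ (if p < T then B else 1) * (p : ℝ) ^ δ := by
    intro p hp
    have hp1 : (1 : ℝ) ≤ p := by exact_mod_cast (Nat.prime_of_mem_primeFactors hp).one_le
    split_ifs with h
    · exact le_mul_of_one_le_right hB0.le (Real.one_le_rpow hp1 hδ.le)
    · have hle : B ^ (1 / δ) ≤ p :=
        (Nat.le_ceil _).trans (by exact_mod_cast not_lt.1 h)
      calc B = (B ^ (1 / δ)) ^ δ := by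
            rw [← Real.rpow_mul hB0.le, one_div_mul_cancel hδ.ne', Real.rpow_one]
        _ ≤ (p : ℝ) ^ δ := Real.rpow_le_rpow (by positivity) hle hδ.le
        _ = 1 * (p : ℝ) ^ δ := (one_mul _).symm
  calc B ^ n.primeFactors.card = ∏ _p ∈ n.primeFactors, B := (Finset.prod_const B).symm
    _ ≤ ∏ p ∈ n.primeFactors, (if p < T then B else 1) * (p : ℝ) ^ δ :=
        Finset.prod_le_prod (fun _ _ => hB0.le) hterm
    _ = B ^ (n.primeFactors.filter (· < T)).card * (n : ℝ) ^ δ := by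
        rw [Finset.prod_mul_distrib, ← Finset.prod_filter, Finset.prod_const,
          Real.finsetProd_rpow _ _ (fun p _ => Nat.cast_nonneg p), ← Nat.cast_prod,
          Nat.prod_primeFactors_of_squarefree hn]
    _ ≤ B ^ T * (n : ℝ) ^ δ := by
        gcongr
        refine (Finset.card_le_card (t := Finset.range T) ?_).trans_eq (Finset.card_range T)
        intro p hp
        simpa using (Finset.mem_filter.1 hp).2

end Tail

theorem stmt_11 (f : MvPolynomial (Fin 2) ℤ) (hsf : Squarefree f)
    (hnc : 1 ≤ f.totalDegree) :
    ∀ ε : ℝ, 0 < ε → ε < 1 → ∃ C : ℝ, 0 < C ∧ ∀ z : ℝ, 1 ≤ z →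
      (∑' n : {m : ℕ // Squarefree m ∧ z ≤ (m : ℝ)},
        (Nat.card (Cf f ((n : ℕ) ^ 2)) : ℝ) /
          (Nat.card (GL (Fin 2) (ZMod ((n : ℕ) ^ 2))) : ℝ)) ≤
        C / z ^ ((1 : ℝ) - ε) := by
  intro ε hε hε1
  obtain ⟨A, hA⟩ := exists_card_zeros_le hsf
  have hB : ∀ p : ℕ, p.Prime → Nat.card (Cf f (p ^ 2)) ≤ (3 * A + 1) * p ^ 6 := by
    intro p hp
    have : Fact p.Prime := ⟨hp⟩
    exact (card_Cf_sq_le (hA p)).trans (Nat.mul_le_mul_right _ (Nat.le_succ _))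
  obtain ⟨D, hD, hDn⟩ := exists_pow_card_primeFactors_le (B := 4 * ((3 * A + 1 : ℕ) : ℝ))
    (δ := ε / 2) (by push_cast; linarith [Nat.cast_nonneg (α := ℝ) A]) (half_pos hε)
  have hsum : Summable fun n : ℕ => 1 / (n : ℝ) ^ (1 + ε / 2) :=
    Real.summable_one_div_nat_rpow.2 (by linarith)
  have hnonneg : ∀ n : ℕ, 0 ≤ 1 / (n : ℝ) ^ (1 + ε / 2) := fun n => by positivity
  refine ⟨D * ∑' n : ℕ, 1 / (n : ℝ) ^ (1 + ε / 2), mul_pos hD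
    (hsum.tsum_pos hnonneg 1 (by simp)), fun z hz => ?_⟩
  have hz0 : 0 < z := one_pos.trans_le hz
  have hterm : ∀ n : {m : ℕ // Squarefree m ∧ z ≤ (m : ℝ)},
      (Nat.card (Cf f ((n : ℕ) ^ 2)) : ℝ) /
          (Nat.card (GL (Fin 2) (ZMod ((n : ℕ) ^ 2))) : ℝ) ≤
        D / z ^ ((1 : ℝ) - ε) * (1 / ((n : ℕ) : ℝ) ^ (1 + ε / 2)) := by
    rintro ⟨n, hn, hzn⟩
    have hn0 : (0 : ℝ) < n := hz0.trans_le hzn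
    calc _ ≤ (4 * ((3 * A + 1 : ℕ) : ℝ)) ^ n.primeFactors.card / (n : ℝ) ^ 2 :=
          card_Cf_sq_div_card_GL_le hB hn
      _ ≤ D * (n : ℝ) ^ (ε / 2) / (n : ℝ) ^ 2 := by
          gcongr
          exact hDn n hn
      _ = D / (n : ℝ) ^ (1 - ε) * (1 / (n : ℝ) ^ (1 + ε / 2)) := by
          have h : (n : ℝ) ^ (2 : ℕ) =
              (n : ℝ) ^ (ε / 2) * ((n : ℝ) ^ (1 - ε) * (n : ℝ) ^ (1 + ε / 2)) := by
            rw [← Real.rpow_add hn0, ← Real.rpow_add hn0, ← Real.rpow_natCast]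
            congr 1
            push_cast
            ring
          rw [h]
          have := Real.rpow_pos_of_pos hn0 (ε / 2)
          field_simp
      _ ≤ D / z ^ (1 - ε) * (1 / (n : ℝ) ^ (1 + ε / 2)) := by
          have : 0 < z ^ (1 - ε) := Real.rpow_pos_of_pos hz0 _
          have hle : z ^ (1 - ε) ≤ (n : ℝ) ^ (1 - ε) :=
            Real.rpow_le_rpow hz0.le hzn (by linarith)
          gcongr
  have hsub : Summable fun n : {m : ℕ // Squarefree m ∧ z ≤ (m : ℝ)} =>
      D / z ^ ((1 : ℝ) - ε) * (1 / ((n : ℕ) : ℝ) ^ (1 + ε / 2)) :=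
    (hsum.subtype _).mul_left _
  calc _ ≤ ∑' n : {m : ℕ // Squarefree m ∧ z ≤ (m : ℝ)},
        D / z ^ ((1 : ℝ) - ε) * (1 / ((n : ℕ) : ℝ) ^ (1 + ε / 2)) :=
        (hsub.of_nonneg_of_le (fun n => by positivity) hterm).tsum_le_tsum hterm hsub
    _ = D / z ^ ((1 : ℝ) - ε) * ∑' n : {m : ℕ // Squarefree m ∧ z ≤ (m : ℝ)},
        (1 / ((n : ℕ) : ℝ) ^ (1 + ε / 2)) := tsum_mul_left
    _ ≤ D / z ^ ((1 : ℝ) - ε) * ∑' n : ℕ, 1 / (n : ℝ) ^ (1 + ε / 2) := by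
        gcongr
        exact hsum.tsum_subtype_le _ {m : ℕ | Squarefree m ∧ z ≤ (m : ℝ)} hnonneg
    _ = _ := by ring
end
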